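/- Let G be a graph on [n] decomposable into G_1 and G_2, i.e. G = G_1 ∪ G_2 with V(G_1) ∩ V(G_2) = {v} where v is a free vertex of both G_1 and G_2 and each G_i contains at least one edge. Let T ∈ C(G), T_1 ∈ C(G_1), T_2 ∈ C(G_2) be cutsets such that either T = T_1 ∪ T_2 or T = T_1 ∪ T_2 ∪ {v}. Then height P_T(G) = height P_{T_1}(G_1) + height P_{T_2}(G_2), the heights of P_{T_i}(G_i) being taken in S_i = K[x_j, y_j : j ∈ V(G_i)]. -/

import Mathlib

/-!
Common definitions: binomial edge ideals, cutsets, the prime ideals `P_T(G)`,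
block graphs, clique degrees, endblocks, decomposability, and their relative
versions for induced subgraphs (an induced subgraph of `G` is recorded by its
vertex set `W`).
-/

noncomputable section
open MvPolynomial

/-- The edge binomial `f_{ij} = x_i y_j - x_j y_i` in `K[x_v, y_v : v ∈ V]`,
encoded as `MvPolynomial (V ⊕ V) K` with `Sum.inl i ↦ x_i`, `Sum.inr i ↦ y_i`. -/
def ebin (K : Type*) [Field K] {V : Type*} (i j : V) : MvPolynomial (V ⊕ V) K :=
  X (Sum.inl i) * X (Sum.inr j) - X (Sum.inl j) * X (Sum.inr i)

/-- The binomial edge ideal `J_G`, generated by the `f_{ij}` over the edges of `G`. -/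
def binomialEdgeIdeal (K : Type*) [Field K] {V : Type*} (G : SimpleGraph V) :
    Ideal (MvPolynomial (V ⊕ V) K) :=
  Ideal.span {p | ∃ i j, G.Adj i j ∧ p = ebin K i j}

/-- The binomial edge ideal of the induced subgraph of `G` on `W`, regarded as an
ideal of the full polynomial ring on all of `V`. -/
def binomialEdgeIdealOn (K : Type*) [Field K] {V : Type*} (G : SimpleGraph V)
    (W : Set V) : Ideal (MvPolynomial (V ⊕ V) K) :=
  Ideal.span {p | ∃ i ∈ W, ∃ j ∈ W, G.Adj i j ∧ p = ebin K i j}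

/-- `c(T)`: the number of connected components of the induced subgraph on `Tᶜ`. -/
def numComp {V : Type*} (G : SimpleGraph V) (T : Set V) : ℕ :=
  Nat.card (G.induce Tᶜ).ConnectedComponent

/-- `T` is a cutset of `G` if `c(T ∖ {i}) < c(T)` for every `i ∈ T`. -/
def IsCutset {V : Type*} (G : SimpleGraph V) (T : Set V) : Prop :=
  ∀ i ∈ T, numComp G (T \ {i}) < numComp G T

/-- The prime ideal `P_T(G)`, generated by the variables `x_i, y_i` for `i ∈ T`
together with all binomials `f_{ij}` with `i ≠ j` in one connected component of
the induced subgraph on `Tᶜ`. -/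
def cutIdeal (K : Type*) [Field K] {V : Type*} (G : SimpleGraph V) (T : Set V) :
    Ideal (MvPolynomial (V ⊕ V) K) :=
  Ideal.span ({p | ∃ i ∈ T, p = X (Sum.inl i) ∨ p = X (Sum.inr i)} ∪
    {p | ∃ i j, ∃ (hi : i ∈ Tᶜ) (hj : j ∈ Tᶜ), i ≠ j ∧
      (G.induce Tᶜ).Reachable ⟨i, hi⟩ ⟨j, hj⟩ ∧ p = ebin K i j})

/-- A graph is a block graph iff all its blocks are complete; equivalently,
the vertices of every cycle form a clique. -/
def IsBlockGraph {V : Type*} (G : SimpleGraph V) : Prop :=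
  ∀ (v : V) (c : G.Walk v v), c.IsCycle →
    ∀ x ∈ c.support, ∀ y ∈ c.support, x ≠ y → G.Adj x y

/-- The clique degree of `v`: the number of maximal cliques of `G` containing `v`. -/
def cliqueDeg {V : Type*} (G : SimpleGraph V) (v : V) : ℕ :=
  {s : Set V | Maximal G.IsClique s ∧ v ∈ s}.ncard

/-- `v` is a cutpoint of `G`: removing it increases the number of connected components. -/
def IsCutpoint {V : Type*} (G : SimpleGraph V) (v : V) : Prop :=
  Nat.card G.ConnectedComponent < Nat.card (G.induce {v}ᶜ).ConnectedComponent

/-- An endblock of a block graph: a maximal clique with at least two vertices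
containing exactly one cutpoint. -/
def IsEndblock {V : Type*} (G : SimpleGraph V) (B : Set V) : Prop :=
  Maximal G.IsClique B ∧ 2 ≤ B.ncard ∧ ∃! w, w ∈ B ∧ IsCutpoint G w

/-- `P_T(G) ∈ Minh(G)`: `T` is a cutset whose prime `P_T(G)` has minimum height
among all `P_{T'}(G)` with `T'` a cutset; since `height P_T(G) = n - c(T) + |T|`,
this says `c(T') + |T| ≤ c(T) + |T'|` for all cutsets `T'`. -/
def InMinh {V : Type*} (G : SimpleGraph V) (T : Set V) : Prop :=
  IsCutset G T ∧ ∀ T', IsCutset G T' →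
    numComp G T' + T.ncard ≤ numComp G T + T'.ncard

/-! Relative versions: the graph under consideration is the induced subgraph of
`G` on the vertex set `W`. -/

/-- Number of connected components of the induced subgraph on `W` after removing `T`. -/
def numCompOn {V : Type*} (G : SimpleGraph V) (W T : Set V) : ℕ :=
  Nat.card (G.induce (W \ T)).ConnectedComponent

/-- `T` is a cutset of the induced subgraph of `G` on `W`. -/
def IsCutsetOn {V : Type*} (G : SimpleGraph V) (W T : Set V) : Prop :=
  T ⊆ W ∧ ∀ i ∈ T, numCompOn G W (T \ {i}) < numCompOn G W T

/-- `P_T ∈ Minh` for the induced subgraph of `G` on `W`. -/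
def InMinhOn {V : Type*} (G : SimpleGraph V) (W T : Set V) : Prop :=
  IsCutsetOn G W T ∧ ∀ T', IsCutsetOn G W T' →
    numCompOn G W T' + T.ncard ≤ numCompOn G W T + T'.ncard

/-- `B` is a maximal clique of the induced subgraph of `G` on `W`. -/
def IsMaxCliqueOn {V : Type*} (G : SimpleGraph V) (W B : Set V) : Prop :=
  Maximal (fun s => s ⊆ W ∧ G.IsClique s) B

/-- Clique degree of `v` in the induced subgraph of `G` on `W`. -/
def cliqueDegOn {V : Type*} (G : SimpleGraph V) (W : Set V) (v : V) : ℕ :=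
  {B : Set V | IsMaxCliqueOn G W B ∧ v ∈ B}.ncard

/-- `w` is a cutpoint of the induced subgraph of `G` on `W`. -/
def IsCutpointOn {V : Type*} (G : SimpleGraph V) (W : Set V) (w : V) : Prop :=
  w ∈ W ∧ Nat.card (G.induce W).ConnectedComponent
    < Nat.card (G.induce (W \ {w})).ConnectedComponent

/-- `B` is an endblock of the induced subgraph of `G` on `W`. -/
def IsEndblockOn {V : Type*} (G : SimpleGraph V) (W B : Set V) : Prop :=
  IsMaxCliqueOn G W B ∧ 2 ≤ B.ncard ∧ ∃! w, w ∈ B ∧ IsCutpointOn G W w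

/-- The induced subgraph of `G` on `W` is decomposable: it is the union of two
subgraphs, each containing an edge, whose vertex sets `W₁, W₂` intersect in a
single vertex that is a free vertex of both. -/
def DecomposableOn {V : Type*} (G : SimpleGraph V) (W : Set V) : Prop :=
  ∃ W₁ W₂ : Set V, ∃ v : V, W₁ ∪ W₂ = W ∧ W₁ ∩ W₂ = {v} ∧
    (∃ a ∈ W₁, ∃ b ∈ W₁, G.Adj a b) ∧ (∃ a ∈ W₂, ∃ b ∈ W₂, G.Adj a b) ∧
    (∀ a b, a ∈ W → b ∈ W → G.Adj a b → (a ∈ W₁ ∧ b ∈ W₁) ∨ (a ∈ W₂ ∧ b ∈ W₂)) ∧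
    cliqueDegOn G W₁ v = 1 ∧ cliqueDegOn G W₂ v = 1

/-- `𝒟` is the decomposition of the induced subgraph of `G` on `W` into
indecomposable components: the members cover `W` and all its edges, each member
is indecomposable (an isolated vertex or a graph with an edge), and two distinct
members meet in at most one vertex, which is free in both. -/
def IsDecompositionOn {V : Type*} (G : SimpleGraph V) (W : Set V)
    (𝒟 : Finset (Set V)) : Prop :=
  (∀ U ∈ 𝒟, U ⊆ W) ∧ ⋃₀ ↑𝒟 = W ∧
  (∀ a b, a ∈ W → b ∈ W → G.Adj a b → ∃ U ∈ 𝒟, a ∈ U ∧ b ∈ U) ∧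
  (∀ U ∈ 𝒟, (∃ a ∈ U, ∃ b ∈ U, G.Adj a b) ∨ (∃ w, U = {w} ∧ ∀ u ∈ W, ¬ G.Adj w u)) ∧
  (∀ U₁ ∈ 𝒟, ∀ U₂ ∈ 𝒟, U₁ ≠ U₂ →
    U₁ ∩ U₂ = ∅ ∨ ∃ w, U₁ ∩ U₂ = {w} ∧ cliqueDegOn G U₁ w = 1 ∧ cliqueDegOn G U₂ w = 1) ∧
  (∀ U ∈ 𝒟, ¬ DecomposableOn G U)

/-- `i(G)`: the number of inner vertices (vertices of clique degree `> 1`) of the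
induced subgraph of `G` on `W`. -/
def innerCountOn {V : Type*} (G : SimpleGraph V) (W : Set V) : ℕ :=
  {v | v ∈ W ∧ 1 < cliqueDegOn G W v}.ncard

open Sum in
/-- The substitution `x_i ↦ x_i x_{r i}`, `y_i ↦ x_i y_{r i}` for `i ∈ A`, which moreover kills
the variables in `Z` and fixes all the others. -/
def starHom (K : Type*) [Field K] {V : Type*} [DecidableEq V] (r : V → V) (A : Finset V)
    (Z : Finset (V ⊕ V)) : MvPolynomial (V ⊕ V) K →ₐ[K] MvPolynomial (V ⊕ V) K :=
  aeval fun s => if s ∈ Z then 0 else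
    Sum.elim (fun i => if i ∈ A then X (inl i) * X (inl (r i)) else X (inl i))
      (fun i => if i ∈ A then X (inl i) * X (inr (r i)) else X (inr i)) s

section StarHom

variable {K : Type*} [Field K] {V : Type*}

lemma ebin_ne_zero {i j : V} (h : i ≠ j) : ebin K i j ≠ 0 := by
  classical
  intro h0
  have := congrArg
    (aeval fun s : V ⊕ V => if s = Sum.inl i ∨ s = Sum.inr j then (1 : K) else 0) h0
  simp [ebin, h, h.symm] at this

lemma ebin_self (i : V) : ebin K i i = 0 := sub_self _

lemma X_mul_ebin (c i j : V) :
    X (Sum.inl c) * ebin K i j = X (Sum.inl j) * ebin K i c - X (Sum.inl i) * ebin K j c := by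
  simp only [ebin]; ring

lemma height_ker_add_one_le {R S S' : Type*} [CommRing R] [CommRing S] [IsDomain S] [CommRing S']
    [IsDomain S'] (φ : R →+* S) (θ : S →+* S') (f : R) (hf : φ f ≠ 0) (hθ : θ (φ f) = 0) :
    (RingHom.ker φ).height + 1 ≤ (RingHom.ker (θ.comp φ)).height := by
  have h1 : (RingHom.ker φ).IsPrime := RingHom.ker_isPrime _
  have h2 : (RingHom.ker (θ.comp φ)).IsPrime := RingHom.ker_isPrime _
  have := Order.height_add_one_le (a := (⟨_, h1⟩ : PrimeSpectrum R)) (b := ⟨_, h2⟩) <| by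
    rw [← PrimeSpectrum.asIdeal_lt_asIdeal]
    refine SetLike.lt_iff_le_and_exists.2 ⟨fun x hx => ?_, f, ?_, ?_⟩
    · simp only [RingHom.mem_ker, RingHom.comp_apply] at hx ⊢
      rw [hx, map_zero]
    · simpa [RingHom.mem_ker] using hθ
    · simpa [RingHom.mem_ker] using hf
  simpa only [← PrimeSpectrum.height_eq_orderHeight] using this

/-- The ideal generated by the variables at `T` and the binomials `f_{ij}` with `i, j ∉ T` in the
same fibre of `r`. -/
def fibreIdeal (K : Type*) [Field K] {V : Type*} (r : V → V) (T : Finset V) :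
    Ideal (MvPolynomial (V ⊕ V) K) :=
  Ideal.span ({p | ∃ i ∈ T, p = X (Sum.inl i) ∨ p = X (Sum.inr i)} ∪
    {p | ∃ i j, i ∉ T ∧ j ∉ T ∧ r i = r j ∧ p = ebin K i j})

lemma X_mem_fibreIdeal {r : V → V} {T : Finset V} {s : V ⊕ V} (hs : s ∈ T.disjSum T) :
    X s ∈ fibreIdeal K r T := by
  refine Ideal.subset_span (Or.inl ?_)
  rcases s with i | i
  · exact ⟨i, by simpa using hs, Or.inl rfl⟩
  · exact ⟨i, by simpa using hs, Or.inr rfl⟩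

variable [DecidableEq V]

lemma starHom_insert_left {r : V → V} {i : V} {A : Finset V} (hi : i ∉ A)
    (hr : ∀ j ∈ insert i A, r j ∉ insert i A) :
    starHom K r (insert i A) ∅ = (starHom K r {i} ∅).comp (starHom K r A ∅) := by
  refine MvPolynomial.algHom_ext fun s => ?_
  rcases s with j | j <;> by_cases hj : j ∈ A <;> by_cases hji : j = i <;>
    have := hr j <;> simp_all [starHom]

lemma starHom_insert_right {r : V → V} {A : Finset V} {z : V ⊕ V} {Z : Finset (V ⊕ V)}
    (hz : z.elim id id ∉ A) (hr : ∀ j ∈ A, r j ≠ z.elim id id) :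
    starHom K r A (insert z Z) = (starHom K r ∅ {z}).comp (starHom K r A Z) := by
  refine MvPolynomial.algHom_ext fun s => ?_
  rcases s with j | j <;> rcases z with k | k <;> by_cases hj : j ∈ A <;>
    by_cases hjk : j = k <;> have := hr j <;> simp_all [starHom] <;> split_ifs <;> simp_all

lemma card_le_height_ker_starHom {r : V → V} {A : Finset V} (hr : ∀ j ∈ A, r j ∉ A) :
    (A.card : ℕ∞) ≤ (RingHom.ker (starHom K r A ∅).toRingHom).height := by
  induction A using Finset.induction_on with
  | empty => simp
  | insert i A hi ih =>
    have hr' : ∀ j ∈ A, r j ∉ A := fun j hj h =>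
      hr j (Finset.mem_insert_of_mem hj) (Finset.mem_insert_of_mem h)
    have hri := hr i (Finset.mem_insert_self _ _)
    have hne : i ≠ r i := fun h => hri (by rw [← h]; exact Finset.mem_insert_self _ _)
    have hA : r i ∉ A := fun h => hri (Finset.mem_insert_of_mem h)
    have hfix : starHom K r A ∅ (ebin K i (r i)) = ebin K i (r i) := by
      simp [starHom, ebin, hi, hA]
    rw [Finset.card_insert_of_notMem hi, starHom_insert_left hi hr, Nat.cast_add, Nat.cast_one]
    refine (add_le_add_left (ih hr') 1).trans (height_ker_add_one_le _ _ (ebin K i (r i)) ?_ ?_)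
    · exact fun h => ebin_ne_zero hne (hfix.symm.trans h)
    · change starHom K r {i} ∅ (starHom K r A ∅ (ebin K i (r i))) = 0
      rw [hfix]
      simp [starHom, ebin, hne.symm]
      ring

lemma card_add_card_le_height_ker_starHom {r : V → V} {A : Finset V} {Z : Finset (V ⊕ V)}
    (hr : ∀ j ∈ A, r j ∉ A) (hZ : ∀ z ∈ Z, z.elim id id ∉ A)
    (hZr : ∀ z ∈ Z, ∀ j ∈ A, r j ≠ z.elim id id) :
    (A.card + Z.card : ℕ∞) ≤ (RingHom.ker (starHom K r A Z).toRingHom).height := by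
  induction Z using Finset.induction_on with
  | empty => simpa using card_le_height_ker_starHom hr
  | insert z Z hz ih =>
    have hzA := hZ z (Finset.mem_insert_self _ _)
    have hfix : starHom K r A Z (X z) = X z := by
      rcases z with i | i <;> simp_all [starHom]
    rw [Finset.card_insert_of_notMem hz,
      starHom_insert_right hzA (hZr z (Finset.mem_insert_self _ _)), Nat.cast_add, Nat.cast_one,
      ← add_assoc]
    refine (add_le_add_left (ih (fun w hw => hZ w (Finset.mem_insert_of_mem hw))
      (fun w hw => hZr w (Finset.mem_insert_of_mem hw))) 1).trans
      (height_ker_add_one_le _ _ (X z) ?_ ?_)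
    · exact fun h => X_ne_zero z (hfix.symm.trans h)
    · change starHom K r ∅ {z} (starHom K r A Z (X z)) = 0
      rw [hfix]
      simp [starHom]

lemma monomial_sub_monomial_mem [Fintype V] {r : V → V} {I : Ideal (MvPolynomial (V ⊕ V) K)}
    (hI : ∀ i j, r i = r j → ebin K i j ∈ I) (m m' : V ⊕ V →₀ ℕ)
    (hrow : ∀ i, m (Sum.inl i) + m (Sum.inr i) = m' (Sum.inl i) + m' (Sum.inr i))
    (hcol : ∀ c, ∑ i with r i = c, m (Sum.inl i) = ∑ i with r i = c, m' (Sum.inl i)) :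
    monomial m 1 - monomial m' 1 ∈ I := by
  induction hN : ∑ i, (m (Sum.inl i) - m' (Sum.inl i)) using Nat.strong_induction_on
    generalizing m with
  | _ N ih =>
  by_cases hle : ∀ i, m (Sum.inl i) ≤ m' (Sum.inl i)
  · have hl : ∀ i, m (Sum.inl i) = m' (Sum.inl i) := fun i =>
      (Finset.sum_eq_sum_iff_of_le fun j _ => hle j).1 (hcol (r i)) i (by simp)
    have : m = m' := by
      ext s
      rcases s with i | i
      · exact hl i
      · have := hrow i; have := hl i; omega
    simp [this]
  push Not at hle
  obtain ⟨i, hi⟩ := hle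
  obtain ⟨j, hj, hij⟩ : ∃ j, r j = r i ∧ m (Sum.inl j) < m' (Sum.inl j) := by
    by_contra! h
    have := Finset.sum_lt_sum (s := Finset.univ.filter fun j => r j = r i)
      (f := fun j => m' (Sum.inl j)) (g := fun j => m (Sum.inl j))
      (fun j hj => h j (by simpa using hj)) ⟨i, by simp, hi⟩
    have := hcol (r i)
    omega
  have hne : i ≠ j := by rintro rfl; omega
  have hjr := hrow j
  obtain ⟨u, rfl⟩ : ∃ u, m = u + (Finsupp.single (Sum.inl i) 1 + Finsupp.single (Sum.inr j) 1) := by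
    refine ⟨m - (Finsupp.single (Sum.inl i) 1 + Finsupp.single (Sum.inr j) 1), ?_⟩
    rw [tsub_add_cancel_of_le]
    intro s
    rcases s with k | k
    · by_cases hk : i = k
      · subst hk; simp; omega
      · simp [hk]
    · by_cases hk : j = k
      · subst hk; simp; omega
      · simp [hk]
  set m₂ := u + (Finsupp.single (Sum.inl j) 1 + Finsupp.single (Sum.inr i) 1) with hm₂
  have key : monomial (u + (Finsupp.single (Sum.inl i) 1 + Finsupp.single (Sum.inr j) 1)) (1 : K)
      - monomial m₂ 1 ∈ I := by
    have : monomial (u + (Finsupp.single (Sum.inl i) 1 + Finsupp.single (Sum.inr j) 1)) (1 : K)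
      - monomial m₂ 1 = monomial u 1 * ebin K i j := by
      simp [hm₂, ebin, X, monomial_mul, mul_sub]
    rw [this]
    exact I.mul_mem_left _ (hI _ _ hj.symm)
  have h2 : monomial m₂ 1 - monomial m' 1 ∈ I := by
    refine ih _ ?_ m₂ ?_ ?_ rfl
    · rw [← hN]
      refine Finset.sum_lt_sum (fun k _ => ?_) ⟨i, by simp, ?_⟩
      · by_cases hk : j = k
        · subst hk; simp [hm₂, hne] at hij ⊢; omega
        · simp [hm₂, hk]; omega
      · simp [hm₂, hne.symm] at hi ⊢; omega
    · intro k
      have := hrow k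
      by_cases hk : i = k <;> by_cases hk' : j = k <;> simp [hm₂, hk, hk'] at this ⊢ <;> omega
    · intro c
      rw [← hcol c]
      simp only [hm₂, Finsupp.add_apply, Finset.sum_add_distrib]
      congr 1
      simp [Finsupp.single_apply, Finset.sum_ite_eq, hj]
  simpa using I.add_mem key h2

open Sum in
/-- The exponent of the monomial that `starHom` assigns to a variable it does not kill. -/
def starExp {V : Type*} [DecidableEq V] (r : V → V) (A : Finset V) : V ⊕ V → (V ⊕ V →₀ ℕ) :=
  Sum.elim (fun i => (if i ∈ A then Finsupp.single (inl i) 1 else 0) + Finsupp.single (inl (r i)) 1)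
    (fun i => (if i ∈ A then Finsupp.single (inl i) 1 else 0) + Finsupp.single (inr (r i)) 1)

lemma starHom_X {r : V → V} {A : Finset V} {Z : Finset (V ⊕ V)} (hfix : ∀ i ∉ A, r i = i)
    {s : V ⊕ V} (hs : s ∉ Z) : starHom K r A Z (X s) = monomial (starExp r A s) 1 := by
  rcases s with i | i <;> by_cases hi : i ∈ A <;>
    simp [starHom, starExp, hs, hi, hfix] <;> simp [X, monomial_mul]

lemma starHom_monomial [Fintype V] {r : V → V} {A : Finset V} {Z : Finset (V ⊕ V)}
    (hfix : ∀ i ∉ A, r i = i) (m : V ⊕ V →₀ ℕ) :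
    starHom K r A Z (monomial m 1) =
      if ∀ z ∈ Z, m z = 0 then monomial (∑ s, m s • starExp r A s) 1 else 0 := by
  have hprod : starHom K r A Z (monomial m 1) = ∏ s, (starHom K r A Z (X s)) ^ m s := by
    rw [monomial_eq, map_one, one_mul, Finsupp.prod_fintype _ _ (by simp), map_prod]
    simp
  rw [hprod]
  split_ifs with h
  · rw [monomial_sum_one]
    refine Finset.prod_congr rfl fun s _ => ?_
    by_cases hs : s ∈ Z
    · simp [h s hs]
    · rw [starHom_X hfix hs, monomial_pow, one_pow]
  · push Not at h
    obtain ⟨z, hz, hm⟩ := h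
    refine Finset.prod_eq_zero (Finset.mem_univ z) ?_
    simp [starHom, hz, hm]

lemma row_eq_and_col_eq_of_starExp [Fintype V] {r : V → V} {A : Finset V} (hr : ∀ i, r i ∉ A)
    (hfix : ∀ i ∉ A, r i = i) {m m' : V ⊕ V →₀ ℕ}
    (h : ∑ s, m s • starExp r A s = ∑ s, m' s • starExp r A s) :
    (∀ i, m (Sum.inl i) + m (Sum.inr i) = m' (Sum.inl i) + m' (Sum.inr i)) ∧
      ∀ c, ∑ i with r i = c, m (Sum.inl i) = ∑ i with r i = c, m' (Sum.inl i) := by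
  have hA : ∀ i ∈ A, ∀ m : V ⊕ V →₀ ℕ,
      (∑ s, m s • starExp r A s) (Sum.inl i) = m (Sum.inl i) + m (Sum.inr i) := by
    intro i hi m
    have hri : ∀ j, r j ≠ i := fun j hj => hr j (hj ▸ hi)
    have hsum : ∀ f : V → ℕ, (∑ j, f j * (if j ∈ A then Finsupp.single (Sum.inl j) 1
        else (0 : V ⊕ V →₀ ℕ)) (Sum.inl i)) = f i := by
      intro f
      rw [Finset.sum_eq_single i]
      · simp [hi]
      · intro j _ hj
        split_ifs <;> simp [hj]
      · simp
    simp only [Finsupp.finsetSum_apply, Finsupp.smul_apply, Fintype.sum_sum_type, starExp,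
      Sum.elim_inl, Sum.elim_inr, Finsupp.add_apply, smul_eq_mul, mul_add, Finset.sum_add_distrib,
      hsum]
    simp [hri]
  have hroot : ∀ c ∉ A, ∀ m : V ⊕ V →₀ ℕ,
      (∑ s, m s • starExp r A s) (Sum.inl c) = ∑ i with r i = c, m (Sum.inl i) ∧
      (∑ s, m s • starExp r A s) (Sum.inr c) = ∑ i with r i = c, m (Sum.inr i) := by
    intro c hc m
    have hzero : ∀ j, (if j ∈ A then Finsupp.single (Sum.inl j) 1
        else (0 : V ⊕ V →₀ ℕ)) (Sum.inl c) = 0 := by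
      intro j
      split_ifs with hj
      · have : j ≠ c := fun h => hc (h ▸ hj)
        simp [this]
      · simp
    have hzero' : ∀ j, (if j ∈ A then Finsupp.single (Sum.inl j) 1
        else (0 : V ⊕ V →₀ ℕ)) (Sum.inr c) = 0 := by
      intro j
      split_ifs <;> simp
    simp only [Finsupp.finsetSum_apply, Finsupp.smul_apply, Fintype.sum_sum_type, starExp,
      Sum.elim_inl, Sum.elim_inr, Finsupp.add_apply, smul_eq_mul, mul_add, Finset.sum_add_distrib,
      hzero, hzero']
    constructor <;> simp [Finset.sum_filter, Finsupp.single_apply]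
  have hcol : ∀ c, ∑ i with r i = c, m (Sum.inl i) = ∑ i with r i = c, m' (Sum.inl i) := by
    intro c
    by_cases hc : c ∈ A
    · have : (Finset.univ.filter fun i => r i = c) = ∅ :=
        Finset.filter_eq_empty_iff.2 fun i _ hi => hr i (hi ▸ hc)
      simp [this]
    · rw [← (hroot c hc m).1, h, (hroot c hc m').1]
  refine ⟨fun i => ?_, hcol⟩
  by_cases hi : i ∈ A
  · rw [← hA i hi, h, hA i hi]
  · have hcol' : ∑ j with r j = i, m (Sum.inr j) = ∑ j with r j = i, m' (Sum.inr j) := by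
      rw [← (hroot i hi m).2, h, (hroot i hi m').2]
    have htot : ∑ j with r j = i, (m (Sum.inl j) + m (Sum.inr j)) =
        ∑ j with r j = i, (m' (Sum.inl j) + m' (Sum.inr j)) := by
      rw [Finset.sum_add_distrib, Finset.sum_add_distrib, hcol, hcol']
    have hmem : i ∈ Finset.univ.filter fun j => r j = i := by simp [hfix i hi]
    rw [← Finset.add_sum_erase _ _ hmem, ← Finset.add_sum_erase _ _ hmem] at htot
    have : ∑ j ∈ (Finset.univ.filter fun j => r j = i).erase i, (m (Sum.inl j) + m (Sum.inr j)) =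
        ∑ j ∈ (Finset.univ.filter fun j => r j = i).erase i, (m' (Sum.inl j) + m' (Sum.inr j)) := by
      refine Finset.sum_congr rfl fun j hj => ?_
      simp only [Finset.mem_erase, Finset.mem_filter, Finset.mem_univ, true_and] at hj
      have hjA : j ∈ A := by
        by_contra hjA
        exact hj.1 ((hfix j hjA).symm.trans hj.2)
      rw [← hA j hjA, h, hA j hjA]
    omega

/-- A homomorphism of polynomial rings sending every monomial to zero or to a monomial has its
kernel in `I` as soon as `I` contains the monomials sent to zero and identifies those with equal
nonzero images. -/
lemma ker_le_of_monomial {σ τ : Type*} (φ : MvPolynomial σ K →ₐ[K] MvPolynomial τ K)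
    (I : Ideal (MvPolynomial σ K)) (D : (σ →₀ ℕ) → Prop) (E : (σ →₀ ℕ) → (τ →₀ ℕ))
    (hD : ∀ m, D m → φ (monomial m 1) = monomial (E m) 1)
    (hD' : ∀ m, ¬ D m → φ (monomial m 1) = 0) (hI : ∀ m, ¬ D m → monomial m 1 ∈ I)
    (hE : ∀ m m', D m → D m' → E m = E m' → monomial m 1 - monomial m' 1 ∈ I) :
    RingHom.ker φ.toRingHom ≤ I := by
  classical
  let L : MvPolynomial τ K →ₗ[K] MvPolynomial σ K ⧸ I :=
    (basisMonomials τ K).constr K fun e =>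
      if h : ∃ m, D m ∧ E m = e then Ideal.Quotient.mk I (monomial h.choose 1) else 0
  have hL : L ∘ₗ φ.toLinearMap = (Ideal.Quotient.mkₐ K I).toLinearMap := by
    refine (basisMonomials σ K).ext fun m => ?_
    simp only [coe_basisMonomials, LinearMap.comp_apply, AlgHom.toLinearMap_apply,
      Ideal.Quotient.mkₐ_eq_mk]
    by_cases hm : D m
    · have hex : ∃ m', D m' ∧ E m' = E m := ⟨m, hm, rfl⟩
      have h1 := (basisMonomials τ K).constr_basis K (fun e =>
        if h : ∃ m, D m ∧ E m = e then Ideal.Quotient.mk I (monomial h.choose 1) else 0) (E m)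
      rw [coe_basisMonomials] at h1
      rw [hD m hm]
      refine h1.trans ?_
      rw [dif_pos hex]
      exact Ideal.Quotient.eq.2 (hE _ _ hex.choose_spec.1 hm hex.choose_spec.2)
    · rw [hD' m hm, map_zero]
      exact (Ideal.Quotient.eq_zero_iff_mem.2 (hI m hm)).symm
  intro f hf
  have hf' : φ f = 0 := hf
  have := LinearMap.congr_fun hL f
  simp only [LinearMap.comp_apply, AlgHom.toLinearMap_apply, hf', map_zero,
    Ideal.Quotient.mkₐ_eq_mk] at this
  exact Ideal.Quotient.eq_zero_iff_mem.1 this.symm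

lemma ebin_mem_fibreIdeal {r : V → V} {T : Finset V} {i j : V} (hij : r i = r j) :
    ebin K i j ∈ fibreIdeal K r T := by
  by_cases hi : i ∈ T
  · exact Ideal.sub_mem _ (Ideal.mul_mem_right _ _ (X_mem_fibreIdeal (by simpa using hi)))
      (Ideal.mul_mem_left _ _ (X_mem_fibreIdeal (by simpa using hi)))
  by_cases hj : j ∈ T
  · exact Ideal.sub_mem _ (Ideal.mul_mem_left _ _ (X_mem_fibreIdeal (by simpa using hj)))
      (Ideal.mul_mem_right _ _ (X_mem_fibreIdeal (by simpa using hj)))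
  exact Ideal.subset_span (Or.inr ⟨i, j, hi, hj, hij, rfl⟩)

section Fibre

variable [Fintype V] {r : V → V} {T : Finset V}

lemma ker_starHom_eq_fibreIdeal (hidem : ∀ i, r (r i) = r i) :
    RingHom.ker (starHom K r {i | r i ≠ i} (T.disjSum T)).toRingHom = fibreIdeal K r T := by
  set A : Finset V := {i | r i ≠ i} with hA
  have hfix : ∀ i ∉ A, r i = i := by simp [hA]
  refine le_antisymm ?_ ?_
  · refine ker_le_of_monomial _ _ (fun m => ∀ z ∈ T.disjSum T, m z = 0)
      (fun m => ∑ s, m s • starExp r A s) (fun m hm => ?_) (fun m hm => ?_) (fun m hm => ?_)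
      (fun m m' _ _ h => ?_)
    · rw [starHom_monomial hfix, if_pos hm]
    · rw [starHom_monomial hfix, if_neg hm]
    · push Not at hm
      obtain ⟨z, hz, hmz⟩ := hm
      exact Ideal.mem_of_dvd _ (X_dvd_monomial.2 (Or.inr hmz)) (X_mem_fibreIdeal hz)
    · obtain ⟨h1, h2⟩ := row_eq_and_col_eq_of_starExp (by simp [hA, hidem]) hfix h
      exact monomial_sub_monomial_mem (fun i j => ebin_mem_fibreIdeal) m m' h1 h2
  · refine Ideal.span_le.2 ?_
    rintro p (⟨i, hi, rfl | rfl⟩ | ⟨i, j, hi, hj, hij, rfl⟩)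
    · change starHom K r A _ _ = 0
      simp [starHom, hi]
    · change starHom K r A _ _ = 0
      simp [starHom, hi]
    · change starHom K r A _ _ = 0
      simp only [ebin, map_sub, map_mul]
      rw [starHom_X hfix (by simpa using hi), starHom_X hfix (by simpa using hj),
        starHom_X hfix (by simpa using hj), starHom_X hfix (by simpa using hi), monomial_mul,
        monomial_mul, sub_eq_zero]
      congr 1
      simp only [starExp, Sum.elim_inl, Sum.elim_inr, hij]
      ac_rfl

lemma fibreIdeal_isPrime (hidem : ∀ i, r (r i) = r i) : (fibreIdeal K r T).IsPrime := by
  rw [← ker_starHom_eq_fibreIdeal hidem]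
  exact RingHom.ker_isPrime _

lemma fibreIdeal_mem_minimalPrimes (hidem : ∀ i, r (r i) = r i)
    (hrT : ∀ i ∉ T, r i ∉ T) : fibreIdeal K r T ∈
    (Ideal.span (X '' (T.disjSum T : Set (V ⊕ V)) ∪
      (fun i => ebin K i (r i)) '' {i | r i ≠ i})).minimalPrimes := by
  refine ⟨⟨fibreIdeal_isPrime hidem, Ideal.span_le.2 ?_⟩, ?_⟩
  · rintro p (⟨s, hs, rfl⟩ | ⟨i, -, rfl⟩)
    · exact X_mem_fibreIdeal hs
    · exact ebin_mem_fibreIdeal (hidem i).symm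
  · rintro Q ⟨hQ, hle⟩ hQP
    have hX : ∀ s ∈ T.disjSum T, X s ∈ Q := fun s hs =>
      hle <| Ideal.subset_span <| Or.inl ⟨s, hs, rfl⟩
    have hE : ∀ i, ebin K i (r i) ∈ Q := by
      intro i
      by_cases hi : r i = i
      · simp [hi, ebin_self]
      · exact hle (Ideal.subset_span (Or.inr ⟨i, hi, rfl⟩))
    refine Ideal.span_le.2 ?_
    rintro p (⟨i, hi, rfl | rfl⟩ | ⟨i, j, hi, hj, hij, rfl⟩)
    · exact hX _ (by simpa using hi)
    · exact hX _ (by simpa using hi)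
    · have hmem : X (Sum.inl (r i)) * ebin K i j ∈ Q := by
        rw [X_mul_ebin]
        exact Q.sub_mem (Q.mul_mem_left _ (hE i)) (Q.mul_mem_left _ (hij ▸ hE j))
      refine (hQ.mem_or_mem hmem).resolve_left fun hc => ?_
      have := hQP hc
      rw [← ker_starHom_eq_fibreIdeal hidem] at this
      have h0 : starHom K r {i | r i ≠ i} (T.disjSum T) (X (Sum.inl (r i))) = 0 := this
      rw [starHom_X (by simp) (by simpa using hrT i hi)] at h0
      simp at h0

theorem height_fibreIdeal (hidem : ∀ i, r (r i) = r i) (hT : ∀ i ∈ T, r i = i)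
    (hrT : ∀ i ∉ T, r i ∉ T) : (fibreIdeal K r T).height =
    ((Finset.card {i | r i ≠ i} + 2 * T.card : ℕ) : ℕ∞) := by
  refine le_antisymm ?_ ?_
  · refine (Ideal.height_le_card_of_mem_minimalPrimes_span (Set.toFinite _)
      (fibreIdeal_mem_minimalPrimes hidem hrT)).trans (Nat.cast_le.2 ?_)
    refine (Set.ncard_union_le _ _).trans ?_
    have h1 := Set.ncard_image_le (s := (T.disjSum T : Set (V ⊕ V)))
      (f := (X : _ → MvPolynomial (V ⊕ V) K))
    have h2 := Set.ncard_image_le (s := {i | r i ≠ i}) (f := fun i => ebin K i (r i))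
    rw [Set.ncard_coe_finset, Finset.card_disjSum] at h1
    rw [Set.ncard_eq_toFinset_card' {i | r i ≠ i}, Set.toFinset_ofPred] at h2
    omega
  · have := card_add_card_le_height_ker_starHom (K := K) (r := r) (A := {i | r i ≠ i})
      (Z := T.disjSum T) (by simp [hidem]) ?_ ?_
    · rw [ker_starHom_eq_fibreIdeal hidem, Finset.card_disjSum] at this
      exact le_trans (by push_cast; rw [two_mul]) this
    · rintro (i | i) hi <;> simpa using hT i (by simpa using hi)
    · rintro (i | i) hi j hj hij <;> refine hrT j (fun hjT => ?_) (hij ▸ by simpa using hi) <;>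
        simp [hT j hjT] at hj

end Fibre

end StarHom

section Graph

variable {V : Type*} {H : SimpleGraph V}

open Classical in
/-- Sends every vertex outside `T` to a representative of its component of `H - T`, and fixes
the vertices of `T`. -/
def compRoot (H : SimpleGraph V) (T : Set V) (i : V) : V :=
  if hi : i ∈ Tᶜ then ((H.induce Tᶜ).connectedComponentMk ⟨i, hi⟩).out else i

lemma compRoot_of_mem {T : Set V} {i : V} (hi : i ∈ T) : compRoot H T i = i :=
  dif_neg (not_not.2 hi)

lemma compRoot_of_notMem {T : Set V} {i : V} (hi : i ∈ Tᶜ) :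
    compRoot H T i = ((H.induce Tᶜ).connectedComponentMk ⟨i, hi⟩).out :=
  dif_pos hi

lemma compRoot_notMem {T : Set V} {i : V} (hi : i ∉ T) : compRoot H T i ∉ T := by
  rw [compRoot_of_notMem hi]
  exact (Quot.out ((H.induce Tᶜ).connectedComponentMk ⟨i, hi⟩)).2

lemma compRoot_out {T : Set V} (c : (H.induce Tᶜ).ConnectedComponent) :
    compRoot H T (Quot.out c).1 = (Quot.out c).1 := by
  rw [compRoot_of_notMem (Quot.out c).2]
  exact congrArg (fun d => (Quot.out d).1) (Quot.out_eq c)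

lemma compRoot_compRoot (T : Set V) (i : V) :
    compRoot H T (compRoot H T i) = compRoot H T i := by
  by_cases hi : i ∈ T
  · rw [compRoot_of_mem hi, compRoot_of_mem hi]
  · rw [compRoot_of_notMem (i := i) hi, compRoot_out]

lemma compRoot_eq_iff {T : Set V} {i j : V} (hi : i ∈ Tᶜ) (hj : j ∈ Tᶜ) :
    compRoot H T i = compRoot H T j ↔ (H.induce Tᶜ).Reachable ⟨i, hi⟩ ⟨j, hj⟩ := by
  rw [compRoot_of_notMem hi, compRoot_of_notMem hj, ← SimpleGraph.ConnectedComponent.eq]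
  refine ⟨fun h => ?_, fun h => by rw [h]⟩
  have := congrArg (H.induce Tᶜ).connectedComponentMk (Subtype.ext h)
  exact (Quot.out_eq _).symm.trans (this.trans (Quot.out_eq _))

lemma cutIdeal_eq_fibreIdeal (K : Type*) [Field K] (T : Finset V) :
    cutIdeal K H T = fibreIdeal K (compRoot H T) T := by
  refine le_antisymm (Ideal.span_le.2 ?_) (Ideal.span_le.2 ?_)
  · rintro p (⟨i, hi, hp⟩ | ⟨i, j, hi, hj, -, hij, hp⟩)
    · exact Ideal.subset_span (Or.inl ⟨i, hi, hp⟩)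
    · exact Ideal.subset_span (Or.inr ⟨i, j, hi, hj, (compRoot_eq_iff hi hj).2 hij, hp⟩)
  · rintro p (⟨i, hi, hp⟩ | ⟨i, j, hi, hj, hij, rfl⟩)
    · exact Ideal.subset_span (Or.inl ⟨i, hi, hp⟩)
    · by_cases hne : i = j
      · rw [hne, ebin_self]
        exact zero_mem _
      · exact Ideal.subset_span
          (Or.inr ⟨i, j, hi, hj, hne, (compRoot_eq_iff (T := (T : Set V)) hi hj).1 hij, rfl⟩)

lemma card_compRoot_ne [Fintype V] [DecidableEq V] (T : Finset V) :
    Finset.card {i | compRoot H T i ≠ i} + T.card + numComp H T = Fintype.card V := by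
  have hcomp : numComp H T = Finset.card {i | i ∉ T ∧ compRoot H T i = i} := by
    rw [numComp, ← Nat.card_eq_finsetCard]
    refine Nat.card_congr
      { toFun := fun c => ⟨(Quot.out c).1, ?_⟩
        invFun := fun i => (H.induce (T : Set V)ᶜ).connectedComponentMk
          ⟨i.1, (Finset.mem_filter.1 i.2).2.1⟩
        left_inv := fun c => Quot.out_eq c
        right_inv := fun i => Subtype.ext ?_ }
    · exact Finset.mem_filter.2 ⟨Finset.mem_univ _, (Quot.out c).2, compRoot_out c⟩
    · have hi := (Finset.mem_filter.1 i.2).2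
      exact (compRoot_of_notMem (T := (T : Set V)) hi.1).symm.trans hi.2
  have h1 := Finset.card_filter_add_card_filter_not (s := Finset.univ)
    (fun i => compRoot H T i = i)
  have h2 := Finset.card_filter_add_card_filter_not
    (s := Finset.univ.filter fun i => compRoot H T i = i) (fun i => i ∈ T)
  have h3 : ((Finset.univ.filter fun i => compRoot H T i = i).filter fun i => i ∈ T) = T := by
    ext i
    simp only [Finset.mem_filter, Finset.mem_univ, true_and, and_iff_right_iff_imp]
    exact fun hi => compRoot_of_mem hi
  have h4 : ((Finset.univ.filter fun i => compRoot H T i = i).filter fun i => i ∉ T) =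
      Finset.univ.filter fun i => i ∉ T ∧ compRoot H T i = i := by
    ext i
    simp [and_comm]
  rw [h3, h4] at h2
  rw [Finset.card_univ] at h1
  simp only [ne_eq]
  omega

/-- The ideal `P_T(H)` is prime, of height `|V| - c(T) + |T|`. -/
theorem exists_isPrime_cutIdeal_and_height [Finite V] (K : Type*) [Field K] (T : Set V) :
    ∃ (h : (cutIdeal K H T).IsPrime) (k : ℕ),
      Order.height (⟨cutIdeal K H T, h⟩ : PrimeSpectrum (MvPolynomial (V ⊕ V) K)) = k ∧
        k + numComp H T = Nat.card V + T.ncard := by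
  classical
  have := Fintype.ofFinite V
  lift T to Finset V using T.toFinite
  have hprime : (cutIdeal K H T).IsPrime := by
    rw [cutIdeal_eq_fibreIdeal]
    exact fibreIdeal_isPrime (compRoot_compRoot _)
  refine ⟨hprime, Finset.card {i | compRoot H T i ≠ i} + 2 * T.card, ?_, ?_⟩
  · rw [← PrimeSpectrum.height_eq_orderHeight]
    change (cutIdeal K H (T : Set V)).height = _
    rw [cutIdeal_eq_fibreIdeal]
    exact height_fibreIdeal (compRoot_compRoot _) (fun i hi => compRoot_of_mem hi)
      (fun i hi => compRoot_notMem hi)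
  · rw [Set.ncard_coe_finset, Nat.card_eq_fintype_card, ← card_compRoot_ne (H := H) T]
    omega

lemma reachable_map_of_adj {V' : Type*} {H' : SimpleGraph V'} (f : V → V')
    (hf : ∀ a b, H.Adj a b → H'.Reachable (f a) (f b)) {a b : V} (h : H.Reachable a b) :
    H'.Reachable (f a) (f b) := by
  obtain ⟨p⟩ := h
  induction p with
  | nil => exact .refl _
  | cons hadj _ ih => exact (hf _ _ hadj).trans ih

/-- Deleting a vertex whose neighbours are pairwise adjacent does not create components. -/
lemma numComp_insert_le [Finite V] {v : V}
    (hv : ∀ a b, H.Adj v a → H.Adj v b → a ≠ b → H.Adj a b) (T : Set V) :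
    numComp H (insert v T) ≤ numComp H T := by
  classical
  have hsub : (insert v T)ᶜ ⊆ Tᶜ := Set.compl_subset_compl.2 (Set.subset_insert v T)
  let ι : H.induce (insert v T)ᶜ →g H.induce Tᶜ := (SimpleGraph.induceHomOfLE H hsub).toHom
  refine Nat.card_le_card_of_injective (SimpleGraph.ConnectedComponent.map ι) ?_
  intro c d
  induction c using SimpleGraph.ConnectedComponent.ind with | _ a => ?_
  induction d using SimpleGraph.ConnectedComponent.ind with | _ b => ?_
  intro h
  have hab : (H.induce Tᶜ).Reachable (ι a) (ι b) := SimpleGraph.ConnectedComponent.exact h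
  refine SimpleGraph.ConnectedComponent.sound ?_
  obtain ⟨w, hw⟩ : ∃ w : ↥(insert v T)ᶜ, (∃ u ∈ Tᶜ, H.Adj v u) → H.Adj v w := by
    by_cases hex : ∃ u ∈ Tᶜ, H.Adj v u
    · obtain ⟨u, hu, hvu⟩ := hex
      exact ⟨⟨u, by simpa [hvu.ne'] using hu⟩, fun _ => hvu⟩
    · exact ⟨a, fun h => absurd h hex⟩
  let f : ↥Tᶜ → ↥(insert v T)ᶜ := fun x =>
    if hx : (x : V) = v then w else ⟨x, fun h => h.elim hx x.2⟩
  have hfv : ∀ x : ↥Tᶜ, (x : V) = v → f x = w := fun x hx => dif_pos hx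
  have hfx : ∀ (x : ↥Tᶜ) (hx : (x : V) ≠ v), f x = ⟨x, fun h => h.elim hx x.2⟩ :=
    fun x hx => dif_neg hx
  have hfι : ∀ x, f (ι x) = x := fun x => hfx (ι x) (fun h => x.2 (Or.inl h))
  have hstep : ∀ x y : ↥Tᶜ, (x : V) = v → H.Adj x y →
      (H.induce (insert v T)ᶜ).Reachable (f x) (f y) := by
    intro x y hx hxy
    have hy : (y : V) ≠ v := fun h => hxy.ne (hx.trans h.symm)
    rw [hfv x hx, hfx y hy]
    rw [hx] at hxy
    have hvw := hw ⟨y, y.2, hxy⟩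
    by_cases hwy : (w : V) = y
    · rw [show w = ⟨(y : V), fun h => h.elim hy y.2⟩ from Subtype.ext hwy]
    · exact SimpleGraph.Adj.reachable (hv _ _ hvw hxy hwy)
  have := reachable_map_of_adj (H' := H.induce (insert v T)ᶜ) f (fun x y hxy => ?_) hab
  · rwa [hfι, hfι] at this
  · have hxy' : H.Adj x y := hxy
    by_cases hx : (x : V) = v
    · exact hstep x y hx hxy'
    · by_cases hy : (y : V) = v
      · exact (hstep y x hy hxy'.symm).symm
      · rw [hfx x hx, hfx y hy]
        exact SimpleGraph.Adj.reachable hxy'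

lemma IsCutset.notMem_of_adj [Finite V] {T : Set V} (hT : IsCutset H T) {v : V}
    (hv : ∀ a b, H.Adj v a → H.Adj v b → a ≠ b → H.Adj a b) : v ∉ T := by
  intro hvT
  have h1 := hT v hvT
  have h2 := numComp_insert_le hv (T \ {v})
  rw [Set.insert_sdiff_singleton, Set.insert_eq_of_mem hvT] at h2
  omega

lemma adj_of_cliqueDegOn_eq_one [Finite V] {W : Set V} {v : V} (h : cliqueDegOn H W v = 1)
    (hvW : v ∈ W) {a b : V} (ha : a ∈ W) (hb : b ∈ W) (hva : H.Adj v a) (hvb : H.Adj v b)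
    (hab : a ≠ b) : H.Adj a b := by
  obtain ⟨B, hB⟩ := Set.ncard_eq_one.1 h
  have key : ∀ c ∈ W, H.Adj v c → IsMaxCliqueOn H W B ∧ c ∈ B := by
    intro c hc hvc
    obtain ⟨M, hle, hM⟩ := (Set.toFinite {s | s ⊆ W ∧ H.IsClique s}).exists_le_maximal
      (a := {v, c}) ⟨by simp [Set.insert_subset_iff, hvW, hc], by simp [hvc]⟩
    have hMB : M ∈ {B : Set V | IsMaxCliqueOn H W B ∧ v ∈ B} := ⟨hM, hle (by simp)⟩
    rw [hB] at hMB
    rw [← Set.mem_singleton_iff.1 hMB]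
    exact ⟨hM, hle (by simp)⟩
  obtain ⟨hBmax, haB⟩ := key a ha hva
  exact hBmax.prop.2 haB (key b hb hvb).2 hab

section Gluing

variable {W₁ W₂ : Set V} {S₁ : Set ↥W₁} {S₂ : Set ↥W₂} {S : Set V}

/-- The map from the components of `H[W] - S₁` to those of `H - S`. -/
def compMap (H : SimpleGraph V) {W : Set V} {S₁ : Set ↥W} {S : Set V}
    (h : ∀ a : ↥W, a ∉ S₁ → (a : V) ∉ S) :
    ((H.induce W).induce S₁ᶜ).ConnectedComponent → (H.induce Sᶜ).ConnectedComponent :=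
  SimpleGraph.ConnectedComponent.map
    (⟨fun a => ⟨a.1.1, h a.1 a.2⟩, fun h => h⟩ : (H.induce W).induce S₁ᶜ →g H.induce Sᶜ)

lemma range_compMap_union (hunion : W₁ ∪ W₂ = Set.univ) (h₁ : ∀ a : ↥W₁, a ∉ S₁ ↔ (a : V) ∉ S)
    (h₂ : ∀ a : ↥W₂, a ∉ S₂ ↔ (a : V) ∉ S) :
    Set.range (compMap H fun a => (h₁ a).1) ∪ Set.range (compMap H fun a => (h₂ a).1) =
      Set.univ := by
  refine Set.eq_univ_of_forall fun c => ?_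
  induction c using SimpleGraph.ConnectedComponent.ind with | _ a => ?_
  have ha : (a : V) ∈ W₁ ∪ W₂ := hunion ▸ Set.mem_univ _
  rcases ha with ha | ha
  · exact Or.inl ⟨SimpleGraph.connectedComponentMk _ ⟨⟨a, ha⟩, (h₁ ⟨a, ha⟩).2 a.2⟩, rfl⟩
  · exact Or.inr ⟨SimpleGraph.connectedComponentMk _ ⟨⟨a, ha⟩, (h₂ ⟨a, ha⟩).2 a.2⟩, rfl⟩

lemma numComp_le_add [Finite V] (hunion : W₁ ∪ W₂ = Set.univ) (h₁ : ∀ a : ↥W₁, a ∉ S₁ ↔ (a : V) ∉ S)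
    (h₂ : ∀ a : ↥W₂, a ∉ S₂ ↔ (a : V) ∉ S) :
    numComp H S ≤ numComp (H.induce W₁) S₁ + numComp (H.induce W₂) S₂ := by
  rw [numComp, ← Set.ncard_univ, ← range_compMap_union hunion h₁ h₂]
  refine (Set.ncard_union_le _ _).trans (add_le_add ?_ ?_) <;>
    · rw [← Set.image_univ]
      exact (Set.ncard_image_le).trans (Set.ncard_univ _).le

lemma exists_retract {v : V} (hinter : W₁ ∩ W₂ = {v})
    (hedges : ∀ a b, H.Adj a b → (a ∈ W₁ ∧ b ∈ W₁) ∨ (a ∈ W₂ ∧ b ∈ W₂))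
    (h₁ : ∀ a : ↥W₁, a ∉ S₁ ↔ (a : V) ∉ S) (hv : v ∉ S) :
    ∃ f : ↥Sᶜ → ↥S₁ᶜ, (∀ x : ↥Sᶜ, (x : V) ∈ W₁ → (f x : V) = x) ∧
      (∀ x : ↥Sᶜ, (x : V) ∈ W₂ → (f x : V) = v) ∧
      ∀ x y, (H.induce Sᶜ).Reachable x y →
        ((H.induce W₁).induce S₁ᶜ).Reachable (f x) (f y) := by
  classical
  have hv12 : v ∈ W₁ ∩ W₂ := hinter ▸ rfl
  let w : ↥S₁ᶜ := ⟨⟨v, hv12.1⟩, (h₁ ⟨v, hv12.1⟩).2 hv⟩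
  let f : ↥Sᶜ → ↥S₁ᶜ := fun x =>
    if hx : (x : V) ∈ W₁ then ⟨⟨x, hx⟩, (h₁ ⟨x, hx⟩).2 x.2⟩ else w
  have hf1 : ∀ x : ↥Sᶜ, (x : V) ∈ W₁ → (f x : V) = x := fun x hx => by simp [f, hx]
  have hf2 : ∀ x : ↥Sᶜ, (x : V) ∈ W₂ → (f x : V) = v := fun x hx => by
    by_cases hx1 : (x : V) ∈ W₁
    · rw [hf1 x hx1]
      have : (x : V) ∈ W₁ ∩ W₂ := ⟨hx1, hx⟩
      rwa [hinter] at this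
    · simp [f, hx1, w]
  refine ⟨f, hf1, hf2, fun x y hxy => reachable_map_of_adj f (fun a b hab => ?_) hxy⟩
  have hab' : H.Adj a b := hab
  rcases hedges _ _ hab' with ⟨ha, hb⟩ | ⟨ha, hb⟩
  · refine SimpleGraph.Adj.reachable (?_ : H.Adj (f a) (f b))
    rwa [hf1 a ha, hf1 b hb]
  · rw [show f a = f b from Subtype.ext (Subtype.ext ((hf2 a ha).trans (hf2 b hb).symm))]

lemma compMap_injective {v : V} (hinter : W₁ ∩ W₂ = {v})
    (hedges : ∀ a b, H.Adj a b → (a ∈ W₁ ∧ b ∈ W₁) ∨ (a ∈ W₂ ∧ b ∈ W₂))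
    (h₁ : ∀ a : ↥W₁, a ∉ S₁ ↔ (a : V) ∉ S) (hv : v ∉ S) :
    Function.Injective (compMap H fun a => (h₁ a).1) := by
  obtain ⟨f, hf1, -, hf⟩ := exists_retract hinter hedges h₁ hv
  intro c d
  induction c using SimpleGraph.ConnectedComponent.ind with | _ a => ?_
  induction d using SimpleGraph.ConnectedComponent.ind with | _ b => ?_
  intro h
  have := hf _ _ (SimpleGraph.ConnectedComponent.exact h)
  refine SimpleGraph.ConnectedComponent.sound ?_
  convert this
  · exact Subtype.ext (Subtype.ext (hf1 ⟨a.1.1, (h₁ a.1).1 a.2⟩ a.1.2).symm)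
  · exact Subtype.ext (Subtype.ext (hf1 ⟨b.1.1, (h₁ b.1).1 b.2⟩ b.1.2).symm)

lemma numComp_add_one_eq [Finite V] {v : V} (hinter : W₁ ∩ W₂ = {v}) (hunion : W₁ ∪ W₂ = Set.univ)
    (hedges : ∀ a b, H.Adj a b → (a ∈ W₁ ∧ b ∈ W₁) ∨ (a ∈ W₂ ∧ b ∈ W₂))
    (h₁ : ∀ a : ↥W₁, a ∉ S₁ ↔ (a : V) ∉ S) (h₂ : ∀ a : ↥W₂, a ∉ S₂ ↔ (a : V) ∉ S)
    (hv : v ∉ S) :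
    numComp H S + 1 = numComp (H.induce W₁) S₁ + numComp (H.induce W₂) S₂ := by
  have hv12 : v ∈ W₁ ∩ W₂ := hinter ▸ rfl
  have hinj₁ := compMap_injective hinter hedges h₁ hv
  have hinj₂ := compMap_injective (Set.inter_comm W₁ W₂ ▸ hinter)
    (fun a b hab => (hedges a b hab).symm) h₂ hv
  have hint : Set.range (compMap H fun a => (h₁ a).1) ∩ Set.range (compMap H fun a => (h₂ a).1) =
      {(H.induce Sᶜ).connectedComponentMk ⟨v, hv⟩} := by
    refine Set.Subset.antisymm ?_ ?_
    · rintro _ ⟨⟨c, rfl⟩, d, hcd⟩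
      induction c using SimpleGraph.ConnectedComponent.ind with | _ a => ?_
      induction d using SimpleGraph.ConnectedComponent.ind with | _ b => ?_
      obtain ⟨f, hf1, hf2, hf⟩ := exists_retract hinter hedges h₁ hv
      have := hf _ _ (SimpleGraph.ConnectedComponent.exact hcd.symm)
      refine SimpleGraph.ConnectedComponent.sound ?_
      have h3 := reachable_map_of_adj (H' := H.induce Sᶜ) (fun a : ↥S₁ᶜ => ⟨a.1.1, (h₁ a.1).1 a.2⟩)
        (fun x y hxy => SimpleGraph.Adj.reachable hxy) this
      have ha : (f ⟨a.1.1, (h₁ a.1).1 a.2⟩ : V) = a.1.1 := hf1 _ a.1.2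
      have hb : (f ⟨b.1.1, (h₂ b.1).1 b.2⟩ : V) = v := hf2 _ b.1.2
      exact (congrArg₂ (H.induce Sᶜ).Reachable (Subtype.ext ha) (Subtype.ext hb)).mp h3
    · rintro _ rfl
      exact ⟨⟨SimpleGraph.connectedComponentMk _ ⟨⟨v, hv12.1⟩, (h₁ ⟨v, hv12.1⟩).2 hv⟩, rfl⟩,
        ⟨SimpleGraph.connectedComponentMk _ ⟨⟨v, hv12.2⟩, (h₂ ⟨v, hv12.2⟩).2 hv⟩, rfl⟩⟩
  have := Set.ncard_union_add_ncard_inter (Set.range (compMap H fun a => (h₁ a).1))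
    (Set.range (compMap H fun a => (h₂ a).1))
  rw [hint, range_compMap_union hunion h₁ h₂, Set.ncard_singleton, Set.ncard_univ,
    ← Set.image_univ, ← Set.image_univ, Set.ncard_image_of_injective _ hinj₁,
    Set.ncard_image_of_injective _ hinj₂, Set.ncard_univ, Set.ncard_univ] at this
  exact this

end Gluing

end Graph

/-- if `G` is decomposable into `G₁` and `G₂` meeting in the free
vertex `v`, and `T ∈ C(G)`, `T₁ ∈ C(G₁)`, `T₂ ∈ C(G₂)` with `T = T₁ ∪ T₂` or
`T = T₁ ∪ T₂ ∪ {v}`, then `height P_T(G) = height P_{T₁}(G₁) + height P_{T₂}(G₂)`. -/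
theorem height_cutIdeal_of_decomposition (n : ℕ) (K : Type*) [Field K]
    (G : SimpleGraph (Fin n)) (W₁ W₂ : Set (Fin n)) (v : Fin n)
    (hunion : W₁ ∪ W₂ = Set.univ) (hinter : W₁ ∩ W₂ = {v})
    (hedges : ∀ a b, G.Adj a b → (a ∈ W₁ ∧ b ∈ W₁) ∨ (a ∈ W₂ ∧ b ∈ W₂))
    (he₁ : ∃ a ∈ W₁, ∃ b ∈ W₁, G.Adj a b) (he₂ : ∃ a ∈ W₂, ∃ b ∈ W₂, G.Adj a b)
    (hfree₁ : cliqueDegOn G W₁ v = 1) (hfree₂ : cliqueDegOn G W₂ v = 1)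
    (T : Set (Fin n)) (T₁ : Set ↥W₁) (T₂ : Set ↥W₂)
    (hT : IsCutset G T) (hT₁ : IsCutset (G.induce W₁) T₁)
    (hT₂ : IsCutset (G.induce W₂) T₂)
    (heq : T = Subtype.val '' T₁ ∪ Subtype.val '' T₂ ∨
           T = insert v (Subtype.val '' T₁ ∪ Subtype.val '' T₂)) :
    ∃ (h : (cutIdeal K G T).IsPrime)
      (h₁ : (cutIdeal K (G.induce W₁) T₁).IsPrime)
      (h₂ : (cutIdeal K (G.induce W₂) T₂).IsPrime),
      Order.height (⟨cutIdeal K G T, h⟩ :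
          PrimeSpectrum (MvPolynomial (Fin n ⊕ Fin n) K))
        = Order.height (⟨cutIdeal K (G.induce W₁) T₁, h₁⟩ :
            PrimeSpectrum (MvPolynomial (↥W₁ ⊕ ↥W₁) K))
          + Order.height (⟨cutIdeal K (G.induce W₂) T₂, h₂⟩ :
              PrimeSpectrum (MvPolynomial (↥W₂ ⊕ ↥W₂) K)) := by
  have hv12 : v ∈ W₁ ∩ W₂ := hinter ▸ rfl
  have hv₁ : (⟨v, hv12.1⟩ : ↥W₁) ∉ T₁ := hT₁.notMem_of_adj fun (a b : ↥W₁) ha hb hab =>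
    adj_of_cliqueDegOn_eq_one hfree₁ hv12.1 a.2 b.2 ha hb (Subtype.coe_ne_coe.2 hab)
  have hv₂ : (⟨v, hv12.2⟩ : ↥W₂) ∉ T₂ := hT₂.notMem_of_adj fun (a b : ↥W₂) ha hb hab =>
    adj_of_cliqueDegOn_eq_one hfree₂ hv12.2 a.2 b.2 ha hb (Subtype.coe_ne_coe.2 hab)
  obtain ⟨h, k, hk, hkc⟩ := exists_isPrime_cutIdeal_and_height (H := G) K T
  obtain ⟨h₁, k₁, hk₁, hkc₁⟩ := exists_isPrime_cutIdeal_and_height (H := G.induce W₁) K T₁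
  obtain ⟨h₂, k₂, hk₂, hkc₂⟩ := exists_isPrime_cutIdeal_and_height (H := G.induce W₂) K T₂
  refine ⟨h, h₁, h₂, ?_⟩
  rw [hk, hk₁, hk₂, ← Nat.cast_add, Nat.cast_inj]
  set U : Set (Fin n) := Subtype.val '' T₁ ∪ Subtype.val '' T₂ with hU
  have hvU : v ∉ U := by
    rintro (⟨a, ha, hav⟩ | ⟨a, ha, hav⟩)
    · exact hv₁ (by rwa [show a = ⟨v, hv12.1⟩ from Subtype.ext hav] at ha)
    · exact hv₂ (by rwa [show a = ⟨v, hv12.2⟩ from Subtype.ext hav] at ha)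
  have hU₁ : ∀ a : ↥W₁, a ∉ T₁ ↔ (a : Fin n) ∉ U := by
    refine fun a => not_congr ⟨fun ha => Or.inl ⟨a, ha, rfl⟩, ?_⟩
    rintro (⟨b, hb, hba⟩ | ⟨b, hb, hba⟩)
    · rwa [← Subtype.ext hba]
    · have : (b : Fin n) ∈ W₁ ∩ W₂ := ⟨hba ▸ a.2, b.2⟩
      rw [hinter] at this
      exact absurd (Or.inr ⟨b, hb, this⟩) hvU
  have hU₂ : ∀ a : ↥W₂, a ∉ T₂ ↔ (a : Fin n) ∉ U := by
    refine fun a => not_congr ⟨fun ha => Or.inr ⟨a, ha, rfl⟩, ?_⟩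
    rintro (⟨b, hb, hba⟩ | ⟨b, hb, hba⟩)
    · have : (b : Fin n) ∈ W₁ ∩ W₂ := ⟨b.2, hba ▸ a.2⟩
      rw [hinter] at this
      exact absurd (Or.inl ⟨b, hb, this⟩) hvU
    · rwa [← Subtype.ext hba]
  have hUcard : U.ncard = T₁.ncard + T₂.ncard := by
    rw [hU, Set.ncard_union_eq ?_, Set.ncard_image_of_injective _ Subtype.val_injective,
      Set.ncard_image_of_injective _ Subtype.val_injective]
    rw [Set.disjoint_left]
    rintro _ ⟨a, ha, rfl⟩ ⟨b, hb, hba⟩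
    have : (a : Fin n) ∈ W₁ ∩ W₂ := ⟨a.2, hba ▸ b.2⟩
    rw [hinter] at this
    exact hvU (Or.inl ⟨a, ha, this⟩)
  have hWcard : Nat.card (Fin n) + 1 = Nat.card ↥W₁ + Nat.card ↥W₂ := by
    have := Set.ncard_union_add_ncard_inter W₁ W₂
    rwa [hinter, hunion, Set.ncard_univ, Set.ncard_singleton] at this
  have hglue := numComp_add_one_eq hinter hunion hedges hU₁ hU₂ hvU
  rcases heq with rfl | rfl
  · omega
  · have hcut := hT v (Set.mem_insert _ _)
    rw [Set.insert_sdiff_self_of_notMem hvU] at hcut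
    have hle : numComp G (insert v U) ≤ numComp (G.induce W₁) (insert ⟨v, hv12.1⟩ T₁) +
        numComp (G.induce W₂) (insert ⟨v, hv12.2⟩ T₂) := by
      refine numComp_le_add hunion (fun a => ?_) (fun a => ?_)
      · simp only [Set.mem_insert_iff, not_or, hU₁, Subtype.ext_iff]
      · simp only [Set.mem_insert_iff, not_or, hU₂, Subtype.ext_iff]
    have hle₁ : numComp (G.induce W₁) (insert ⟨v, hv12.1⟩ T₁) ≤ numComp (G.induce W₁) T₁ :=
      numComp_insert_le (fun (a b : ↥W₁) ha hb hab =>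
        adj_of_cliqueDegOn_eq_one hfree₁ hv12.1 a.2 b.2 ha hb (Subtype.coe_ne_coe.2 hab)) _
    have hle₂ : numComp (G.induce W₂) (insert ⟨v, hv12.2⟩ T₂) ≤ numComp (G.induce W₂) T₂ :=
      numComp_insert_le (fun (a b : ↥W₂) ha hb hab =>
        adj_of_cliqueDegOn_eq_one hfree₂ hv12.2 a.2 b.2 ha hb (Subtype.coe_ne_coe.2 hab)) _
    rw [Set.ncard_insert_of_notMem hvU] at hkc
    omega
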